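/- Let n ∈ ℕ with n ≥ 2. Among the polygons with n vertices, all of whose vertices lie in the integer grid [n²]×[n⁴] := {1,…,n²}×{1,…,n⁴}, there exists one, P, with xc(P) ≥ √n/15. -/

import Mathlib

open Metric Set

noncomputable section

/-- A polytope: convex hull of a finite set. -/
def IsPolytope {d : ℕ} (P : Set (EuclideanSpace ℝ (Fin d))) : Prop :=
  ∃ V : Finset (EuclideanSpace ℝ (Fin d)), P = convexHull ℝ (V : Set (EuclideanSpace ℝ (Fin d)))

/-- `P` has an extended formulation with `l` LMIs of size `m`. -/
def HasSdpExtBlocks {d : ℕ} (P : Set (EuclideanSpace ℝ (Fin d))) (l m : ℕ) : Prop :=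
  ∃ (n : ℕ) (φ : EuclideanSpace ℝ (Fin n) →ᵃ[ℝ] EuclideanSpace ℝ (Fin d))
    (M : Fin l → (EuclideanSpace ℝ (Fin n) →ᵃ[ℝ] Matrix (Fin m) (Fin m) ℝ)),
    (∀ i x, (M i x).IsSymm) ∧ P = φ '' {x | ∀ i, (M i x).PosSemidef}

/-- `P` has an extended formulation with a single LMI of size `k`. -/
def HasSdpExt {d : ℕ} (P : Set (EuclideanSpace ℝ (Fin d))) (k : ℕ) : Prop :=
  ∃ (n : ℕ) (φ : EuclideanSpace ℝ (Fin n) →ᵃ[ℝ] EuclideanSpace ℝ (Fin d))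
    (M : EuclideanSpace ℝ (Fin n) →ᵃ[ℝ] Matrix (Fin k) (Fin k) ℝ),
    (∀ x, (M x).IsSymm) ∧ P = φ '' {x | (M x).PosSemidef}

/-- `P` has an extended formulation with `l` linear inequalities. -/
def HasLinExt {d : ℕ} (P : Set (EuclideanSpace ℝ (Fin d))) (l : ℕ) : Prop :=
  ∃ (n : ℕ) (φ : EuclideanSpace ℝ (Fin n) →ᵃ[ℝ] EuclideanSpace ℝ (Fin d))
    (a : Fin l → (EuclideanSpace ℝ (Fin n) →ᵃ[ℝ] ℝ)),
    P = φ '' {x | ∀ i, 0 ≤ a i x}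

open Classical in
/-- Semidefinite extension complexity. -/
def sxc {d : ℕ} (P : Set (EuclideanSpace ℝ (Fin d))) : ℕ :=
  if P = ∅ ∨ ∃ p, P = {p} then 0 else sInf {k | HasSdpExt P k}

open Classical in
/-- Linear extension complexity. -/
def xc {d : ℕ} (P : Set (EuclideanSpace ℝ (Fin d))) : ℕ :=
  if P = ∅ ∨ ∃ p, P = {p} then 0 else sInf {l | HasLinExt P l}

/-- Spectral norm of a square real matrix (the operator norm of the induced map
on Euclidean space; for a symmetric matrix this is the largest absolute value of
an eigenvalue). -/
def specNorm {ι : Type*} [Fintype ι] [DecidableEq ι] (T : Matrix ι ι ℝ) : ℝ :=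
  ‖LinearMap.toContinuousLinearMap (Matrix.toEuclideanLin T)‖

/-- Norm of a linear map into square matrices: the maximum of the spectral norm
of the values over the unit ball. -/
def lmNorm {n : ℕ} {ι : Type*} [Fintype ι] [DecidableEq ι]
    (A : EuclideanSpace ℝ (Fin n) →ₗ[ℝ] Matrix ι ι ℝ) : ℝ :=
  sSup {r | ∃ x : EuclideanSpace ℝ (Fin n), ‖x‖ ≤ 1 ∧ r = specNorm (A x)}

/-- A 0/1-polytope: the convex hull of a set of 0/1-vectors. -/
def IsZeroOnePolytope {d : ℕ} (P : Set (EuclideanSpace ℝ (Fin d))) : Prop :=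
  ∃ V : Set (EuclideanSpace ℝ (Fin d)),
    V ⊆ {x | ∀ i, x i = 0 ∨ x i = 1} ∧ P = convexHull ℝ V


lemma spanner_top {V : Type*} [AddCommGroup V] [Module ℝ V] [FiniteDimensional ℝ V] {n : ℕ}
    (w : Fin n → V) (hw : Submodule.span ℝ (Set.range w) = ⊤) :
    ∃ f : Fin (Module.finrank ℝ V) → Fin n, ∀ j, ∃ c : Fin (Module.finrank ℝ V) → ℝ,
      (∀ s, |c s| ≤ 1) ∧ w j = ∑ s, c s • w (f s) := by
  classical
  obtain ⟨f0, hf0, hspan, hli⟩ :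
      ∃ f : Fin (Module.finrank ℝ V) → V, (∀ i, f i ∈ Set.range w) ∧
        Submodule.span ℝ (Set.range f) = ⊤ ∧ LinearIndependent ℝ f := by
    have h := Submodule.exists_fun_fin_finrank_span_eq ℝ (Set.range w)
    rw [hw, finrank_top] at h
    exact h
  choose g0 hg0 using hf0
  have hg0' : (fun s => w (g0 s)) = f0 := funext hg0
  let e := Module.finBasis ℝ V
  obtain ⟨f, -, hf⟩ := Finset.exists_max_image
    (Finset.univ : Finset (Fin (Module.finrank ℝ V) → Fin n))
    (fun f => |e.det (fun s => w (f s))|) ⟨g0, Finset.mem_univ _⟩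
  have hne0 : e.det (fun s => w (g0 s)) ≠ 0 := by
    rw [hg0']
    exact ((Module.Basis.is_basis_iff_det e).mp ⟨hli, hspan⟩).ne_zero
  have hne : e.det (fun s => w (f s)) ≠ 0 := by
    intro h
    have := hf g0 (Finset.mem_univ _)
    simp only [h, abs_zero] at this
    exact hne0 (abs_nonpos_iff.mp this)
  obtain ⟨hli', hsp'⟩ := (Module.Basis.is_basis_iff_det e).mpr (IsUnit.mk0 _ hne)
  let b := Module.Basis.mk hli' hsp'.ge
  refine ⟨f, fun j => ⟨fun s => b.coord s (w j), fun s => ?_, ?_⟩⟩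
  · have h := DFunLike.congr_fun (Module.Basis.det_smul_mk_coord_eq_det_update e hli' hsp'.ge s) (w j)
    simp only [LinearMap.smul_apply, smul_eq_mul, MultilinearMap.toLinearMap_apply] at h
    have h2 := hf (Function.update f s j) (Finset.mem_univ _)
    have h3 : (fun i => w (Function.update f s j i)) =
        Function.update (fun i => w (f i)) s (w j) := by
      ext i
      by_cases hi : i = s
      · subst hi; simp
      · simp [hi]
    simp only [h3] at h2
    have h4 : |e.det (fun s => w (f s))| * |b.coord s (w j)| ≤ |e.det (fun s => w (f s))| := by
      rw [← abs_mul]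
      refine le_trans (le_of_eq ?_) h2
      exact congrArg abs h
    have h5 := abs_pos.mpr hne
    by_contra h6
    push Not at h6
    nlinarith
  · have hb : ∀ s, b s = w (f s) := fun s => by simp [b]
    calc w j = ∑ s, b.repr (w j) s • b s := (b.sum_repr (w j)).symm
      _ = _ := Finset.sum_congr rfl fun s _ => by rw [hb]; rfl

lemma spanner {V : Type*} [AddCommGroup V] [Module ℝ V] [FiniteDimensional ℝ V] {n R : ℕ}
    (hn : 0 < n) (hR : Module.finrank ℝ V ≤ R) (w : Fin n → V) :
    ∃ f : Fin R → Fin n, ∀ j, ∃ c : Fin R → ℝ,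
      (∀ s, |c s| ≤ 1) ∧ w j = ∑ s, c s • w (f s) := by
  classical
  let S := Submodule.span ℝ (Set.range w)
  let w' : Fin n → S := fun j => ⟨w j, Submodule.subset_span ⟨j, rfl⟩⟩
  have hw' : Submodule.span ℝ (Set.range w') = ⊤ := by
    have : Set.range w' = ((↑) : S → V) ⁻¹' (Set.range w) := by
      ext x
      simp only [Set.mem_range, Set.mem_preimage, w', Subtype.ext_iff]
    rw [this]
    exact Submodule.span_span_coe_preimage
  obtain ⟨f, hf⟩ := spanner_top w' hw'
  have hr : Module.finrank ℝ S ≤ R := (Submodule.finrank_le S).trans hR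
  obtain ⟨q, rfl⟩ := Nat.exists_eq_add_of_le hr
  refine ⟨Fin.append f (fun _ => ⟨0, hn⟩), fun j => ?_⟩
  obtain ⟨c, hc, hcw⟩ := hf j
  refine ⟨Fin.append c (fun _ => 0), fun s => ?_, ?_⟩
  · refine Fin.addCases (fun i => ?_) (fun i => ?_) s
    · simpa using hc i
    · simp
  · rw [Fin.sum_univ_add]
    have := congrArg (Subtype.val) hcw
    simpa [w'] using this

lemma HasLinExt.mono {d : ℕ} {P : Set (EuclideanSpace ℝ (Fin d))} {l k : ℕ}
    (h : HasLinExt P l) (hlk : l ≤ k) : HasLinExt P k := by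
  obtain ⟨q, rfl⟩ := Nat.exists_eq_add_of_le hlk
  obtain ⟨m, φ, a, rfl⟩ := h
  refine ⟨m, φ, Fin.append a (fun _ => 0), ?_⟩
  congr 1
  ext x
  simp only [Set.mem_ofPred_eq]
  constructor
  · intro h i
    refine Fin.addCases (fun i => ?_) (fun i => ?_) i
    · simpa using h i
    · simp
  · intro h i
    simpa using h (Fin.castAdd q i)

lemma hasLinExt_hull {d n : ℕ} (p : Fin n → EuclideanSpace ℝ (Fin d)) :
    HasLinExt (convexHull ℝ (Set.range p)) (n + 2) := by
  let ψ : EuclideanSpace ℝ (Fin n) →ₗ[ℝ] EuclideanSpace ℝ (Fin d) :=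
    ∑ i, (EuclideanSpace.proj (𝕜 := ℝ) i).toLinearMap.smulRight (p i)
  let σ : EuclideanSpace ℝ (Fin n) →ₗ[ℝ] ℝ :=
    ∑ i, (EuclideanSpace.proj (𝕜 := ℝ) i).toLinearMap
  have hσ : ∀ x, σ x = ∑ i, x i := fun x => by simp [σ]
  have hψ : ∀ x, ψ x = ∑ i, x i • p i := fun x => by simp [ψ]
  refine ⟨n, ψ.toAffineMap, Fin.append
    (fun i => (EuclideanSpace.proj (𝕜 := ℝ) i).toLinearMap.toAffineMap)
    ![σ.toAffineMap - AffineMap.const ℝ _ 1, AffineMap.const ℝ _ 1 - σ.toAffineMap], ?_⟩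
  ext y
  constructor
  · intro hy
    have : convexHull ℝ (Set.range p) ⊆
      {y | ∃ x : Fin n → ℝ, (∀ i, 0 ≤ x i) ∧ ∑ i, x i = 1 ∧ ∑ i, x i • p i = y} := by
      apply convexHull_min
      · rintro _ ⟨j, rfl⟩
        refine ⟨Pi.single j 1, fun i => ?_, by simp, ?_⟩
        · by_cases h : i = j
          · subst h; simp
          · simp [h]
        · rw [Finset.sum_eq_single j] <;> simp +contextual
      · rintro _ ⟨x, hx, hx1, rfl⟩ _ ⟨y, hy, hy1, rfl⟩ a b ha hb hab
        refine ⟨fun i => a * x i + b * y i, fun i => ?_, ?_, ?_⟩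
        · have := hx i; have := hy i; positivity
        · rw [Finset.sum_add_distrib, ← Finset.mul_sum, ← Finset.mul_sum, hx1, hy1]; linarith
        · simp [add_smul, Finset.sum_add_distrib, Finset.smul_sum, mul_smul]
    obtain ⟨x, hx, hx1, rfl⟩ := this hy
    refine ⟨WithLp.toLp 2 x, fun i => ?_, ?_⟩
    · refine Fin.addCases (fun i => ?_) (fun i => ?_) i
      · simpa using hx i
      · fin_cases i <;> simp [hσ, hx1]
    · simp [hψ]
  · rintro ⟨x, hx, rfl⟩
    have h1 : ∀ i, 0 ≤ x i := fun i => by simpa using hx (Fin.castAdd 2 i)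
    have h2 : 0 ≤ σ x - 1 := by simpa using hx (Fin.natAdd n 0)
    have h3 : 0 ≤ 1 - σ x := by simpa using hx (Fin.natAdd n 1)
    simp only [LinearMap.coe_toAffineMap, hψ]
    refine (convex_convexHull ℝ _).sum_mem (fun i _ => h1 i) ?_
      (fun i _ => subset_convexHull ℝ _ ⟨i, rfl⟩)
    rw [← hσ]; linarith

lemma affine_comb {d e : ℕ} (φ : EuclideanSpace ℝ (Fin d) →ᵃ[ℝ] EuclideanSpace ℝ (Fin e))
    {ι : Type} [Fintype ι] (c : ι → ℝ) (hc : ∑ i, c i = 1) (x : ι → EuclideanSpace ℝ (Fin d)) :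
    φ (∑ i, c i • x i) = ∑ i, c i • φ (x i) := by
  have h : ∀ y, φ y = φ.linear y + φ 0 := fun y => congrFun φ.decomp y
  rw [h]
  simp_rw [fun i => h (x i), smul_add, Finset.sum_add_distrib, ← Finset.sum_smul, hc]
  simp

lemma affine_comb' {d : ℕ} (φ : EuclideanSpace ℝ (Fin d) →ᵃ[ℝ] ℝ)
    {ι : Type} [Fintype ι] (c : ι → ℝ) (hc : ∑ i, c i = 1) (x : ι → EuclideanSpace ℝ (Fin d)) :
    φ (∑ i, c i • x i) = ∑ i, c i * φ (x i) := by
  have h : ∀ y, φ y = φ.linear y + φ 0 := fun y => congrFun φ.decomp y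
  rw [h]
  simp_rw [fun i => h (x i), mul_add, Finset.sum_add_distrib, ← Finset.sum_mul, hc]
  simp

lemma extract {d n k : ℕ} (hn : 0 < n) {P : Set (EuclideanSpace ℝ (Fin d))} (hP : HasLinExt P k)
    (p : Fin n → EuclideanSpace ℝ (Fin d)) (hp : ∀ j, p j ∈ P) :
    ∃ Z : Fin n → Fin k → ℝ, (∀ j t, 0 ≤ Z j t) ∧ (∀ j t, Z j t ≤ 1) ∧
      (∀ t, ∃ j0, (∀ j, Z j t = 0) ∨ Z j0 t = 1) ∧
      ∀ {ι : Type} [Fintype ι] (f : ι → Fin n) (c : ι → ℝ), ∑ i, c i = 1 →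
        (∀ t, 0 ≤ ∑ i, c i * Z (f i) t) → ∑ i, c i • p (f i) ∈ P := by
  obtain ⟨m, φ, a, rfl⟩ := hP
  choose x hx hxp using hp
  have hmax : ∀ t, ∃ j0, ∀ j, a t (x j) ≤ a t (x j0) := fun t => by
    obtain ⟨j0, -, h⟩ := Finset.exists_max_image (Finset.univ : Finset (Fin n))
      (fun j => a t (x j)) ⟨⟨0, hn⟩, Finset.mem_univ _⟩
    exact ⟨j0, fun j => h j (Finset.mem_univ _)⟩
  choose J hJ using hmax
  have h0 : ∀ j t, 0 ≤ a t (x j) := fun j t => hx j t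
  refine ⟨fun j t => a t (x j) / a t (x (J t)), fun j t => div_nonneg (h0 _ _) (h0 _ _),
    fun j t => div_le_one_of_le₀ (hJ t j) (h0 _ _), fun t => ⟨J t, ?_⟩, ?_⟩
  · by_cases h : a t (x (J t)) = 0
    · left; intro j; simp [h]
    · right; exact div_self h
  · intro ι _ f c hc hcZ
    refine ⟨∑ i, c i • x (f i), fun t => ?_, ?_⟩
    · rw [affine_comb' _ _ hc]
      have h1 := mul_nonneg (hcZ t) (h0 (J t) t)
      refine h1.trans (le_of_eq ?_)
      rw [Finset.sum_mul]
      refine Finset.sum_congr rfl fun i _ => ?_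
      by_cases h : a t (x (J t)) = 0
      · have : a t (x (f i)) = 0 := le_antisymm (h ▸ hJ t _) (h0 _ _)
        simp [this]
      · field_simp
    · rw [affine_comb _ _ hc]
      simp [hxp]

/-- The point on the parabola with abscissa `t`. -/
def ppt (t : ℝ) : EuclideanSpace ℝ (Fin 2) := (EuclideanSpace.equiv (Fin 2) ℝ).symm ![t, t ^ 2]

@[simp] lemma ppt_zero (t : ℝ) : ppt t 0 = t := by simp [ppt]
@[simp] lemma ppt_one (t : ℝ) : ppt t 1 = t ^ 2 := by simp [ppt]

lemma hull_halfspace (S : Set (EuclideanSpace ℝ (Fin 2))) (t : ℝ)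
    (hS : ∀ v ∈ S, 1 ≤ v 1 - 2 * t * v 0 + t ^ 2) :
    ∀ v ∈ convexHull ℝ S, 1 ≤ v 1 - 2 * t * v 0 + t ^ 2 := by
  have : convexHull ℝ S ⊆ {v | 1 ≤ v 1 - 2 * t * v 0 + t ^ 2} := by
    apply convexHull_min hS
    intro x hx y hy a b ha hb hab
    have hx' : 1 ≤ x 1 - 2 * t * x 0 + t ^ 2 := hx
    have hy' : 1 ≤ y 1 - 2 * t * y 0 + t ^ 2 := hy
    change 1 ≤ (a • x + b • y) 1 - 2 * t * (a • x + b • y) 0 + t ^ 2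
    simp only [PiLp.add_apply, PiLp.smul_apply, smul_eq_mul]
    obtain rfl : b = 1 - a := by linarith
    nlinarith [mul_le_mul_of_nonneg_left hx' ha, mul_le_mul_of_nonneg_left hy' hb]
  exact fun v hv => this hv

/-- The homogeneous combination inequality. -/
lemma comb_ineq {n k : ℕ} {P : Set (EuclideanSpace ℝ (Fin 2))} (T : Fin n → ℝ)
    (Z : Fin n → Fin k → ℝ)
    (hZ : ∀ {ι : Type} [Fintype ι] (f : ι → Fin n) (c : ι → ℝ), ∑ i, c i = 1 →
        (∀ t, 0 ≤ ∑ i, c i * Z (f i) t) → ∑ i, c i • ppt (T (f i)) ∈ P)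
    (τ : ℝ) (hP : ∀ v ∈ P, 1 ≤ v 1 - 2 * τ * v 0 + τ ^ 2)
    {ι : Type} [Fintype ι] (f : ι → Fin n) (c : ι → ℝ) (hc : 0 < ∑ i, c i)
    (hcZ : ∀ t, 0 ≤ ∑ i, c i * Z (f i) t) :
    ∑ i, c i ≤ ∑ i, c i * (T (f i) - τ) ^ 2 := by
  have h := hP _ (hZ f (fun i => c i / ∑ i, c i) (by rw [← Finset.sum_div, div_self hc.ne'])
    (fun t => by
      have : ∑ i, c i / (∑ i, c i) * Z (f i) t = (∑ i, c i * Z (f i) t) / ∑ i, c i := by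
        rw [Finset.sum_div]
        exact Finset.sum_congr rfl fun i _ => by ring
      rw [this]
      exact div_nonneg (hcZ t) hc.le))
  simp only [WithLp.ofLp_sum, WithLp.ofLp_smul, Finset.sum_apply, Pi.smul_apply, ppt_zero, ppt_one,
    smul_eq_mul, div_mul_eq_mul_div, ← Finset.sum_div] at h
  set C := ∑ i, c i with hC
  have h2 : ∑ i, c i * (T (f i) - τ) ^ 2 =
      ∑ i, c i * T (f i) ^ 2 - 2 * τ * ∑ i, c i * T (f i) + C * τ ^ 2 := by
    rw [hC, Finset.mul_sum, ← Finset.sum_sub_distrib, Finset.sum_mul, ← Finset.sum_add_distrib]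
    exact Finset.sum_congr rfl fun i _ => by ring
  rw [h2]
  have h3 := mul_le_mul_of_nonneg_left h hc.le
  have h4 : C * ((∑ i, c i * T (f i) ^ 2) / C - 2 * τ * ((∑ i, c i * T (f i)) / C) + τ ^ 2) =
      ∑ i, c i * T (f i) ^ 2 - 2 * τ * ∑ i, c i * T (f i) + C * τ ^ 2 := by
    field_simp
  linarith

/-- The data extracted from an extension of size `k` of the hull of points on the parabola. -/
def GoodData {n k R : ℕ} (P : Set (EuclideanSpace ℝ (Fin 2))) (T : Fin n → ℝ)
    (Z : Fin n → Fin k → ℝ) (F : Fin R → Fin n) : Prop :=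
  (∀ j t, 0 ≤ Z j t) ∧ (∀ j t, Z j t ≤ 1) ∧
      (∀ t, ∃ j0, (∀ j, Z j t = 0) ∨ Z j0 t = 1) ∧
      (∀ {ι : Type} [Fintype ι] (f : ι → Fin n) (c : ι → ℝ), ∑ i, c i = 1 →
        (∀ t, 0 ≤ ∑ i, c i * Z (f i) t) → ∑ i, c i • ppt (T (f i)) ∈ P) ∧
      ∀ j, ∃ c : Fin R → ℝ, (∀ s, |c s| ≤ 1) ∧ ∑ s, c s = 1 ∧ ∑ s, c s * T (F s) = T j ∧
        ∑ s, c s * T (F s) ^ 2 = T j ^ 2 ∧ ∀ t, ∑ s, c s * Z (F s) t = Z j t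

lemma exists_goodData {n k : ℕ} (hn : 0 < n) {P : Set (EuclideanSpace ℝ (Fin 2))}
    (hP : HasLinExt P k) (T : Fin n → ℝ) (hT : ∀ j, ppt (T j) ∈ P) :
    ∃ (Z : Fin n → Fin k → ℝ) (F : Fin (3 + k) → Fin n), GoodData P T Z F := by
  obtain ⟨Z, h0, h1, h2, h3⟩ := extract hn hP (fun j => ppt (T j)) hT
  let w : Fin n → (Fin 3 ⊕ Fin k → ℝ) := fun j => Sum.elim ![1, T j, T j ^ 2] (Z j)
  obtain ⟨F, hF⟩ := spanner (R := 3 + k) hn (by simp) w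
  refine ⟨Z, F, h0, h1, h2, h3, fun j => ?_⟩
  obtain ⟨c, hc, hw⟩ := hF j
  refine ⟨c, hc, ?_, ?_, ?_, fun t => ?_⟩
  · have := congrFun hw (Sum.inl 0)
    simpa [w] using this.symm
  · have := congrFun hw (Sum.inl 1)
    simpa [w] using this.symm
  · have := congrFun hw (Sum.inl 2)
    simpa [w] using this.symm
  · have := congrFun hw (Sum.inr t)
    simpa [w] using this.symm

lemma core {n k R : ℕ} {P P' : Set (EuclideanSpace ℝ (Fin 2))} {T T' : Fin n → ℝ}
    {Z Z' : Fin n → Fin k → ℝ} {F F' : Fin R → Fin n}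
    (hG : GoodData P T Z F) (hG' : GoodData P' T' Z' F') (δ D : ℝ) (hδ : 0 ≤ δ)
    (hT : ∀ s, T (F s) = T' (F' s))
    (hZ : ∀ s t, |Z' (F' s) t - Z (F s) t| ≤ δ)
    (hD : ∀ i j, (T' i - T j) ^ 2 ≤ D) (hsmall : k * (R * δ) * D < 1)
    (j : Fin n) (hP' : ∀ v ∈ P', 1 ≤ v 1 - 2 * T j * v 0 + T j ^ 2) : False := by
  obtain ⟨h0, -, -, -, h4⟩ := hG
  obtain ⟨h0', -, h2', h3', -⟩ := hG'
  obtain ⟨c, hc, hc1, hcT, hcT2, hcZ⟩ := h4 j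
  choose J hJ using h2'
  have hε : 0 ≤ R * δ := by positivity
  have key := comb_ineq T' Z' h3' (T j) hP' (Sum.elim F' J) (Sum.elim c (fun _ : Fin k => R * δ))
    (by simp [hc1]; positivity)
    (fun t => by
      simp only [Fintype.sum_sum_type, Sum.elim_inl, Sum.elim_inr]
      rcases hJ t with hz | h1
      · simp [hz]
      · have e1 : R * δ ≤ ∑ i, R * δ * Z' (J i) t := by
          have := Finset.single_le_sum (f := fun i => R * δ * Z' (J i) t) (s := Finset.univ)
            (fun i _ => mul_nonneg hε (h0' _ _)) (Finset.mem_univ t)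
          simpa [h1] using this
        have e2 : |∑ s, c s * (Z' (F' s) t - Z (F s) t)| ≤ R * δ := by
          refine (Finset.abs_sum_le_sum_abs _ _).trans ?_
          refine (Finset.sum_le_card_nsmul _ _ δ fun s _ => ?_).trans (by simp)
          rw [abs_mul]
          have := mul_le_mul (hc s) (hZ s t) (abs_nonneg _) zero_le_one
          simpa using this
        have e3 : ∑ s, c s * (Z' (F' s) t - Z (F s) t) = ∑ s, c s * Z' (F' s) t - Z j t := by
          rw [← hcZ t, ← Finset.sum_sub_distrib]
          exact Finset.sum_congr rfl fun i _ => by ring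
        have e4 := (abs_le.mp e2).1
        have := h0 j t
        linarith)
  simp only [Fintype.sum_sum_type, Sum.elim_inl, Sum.elim_inr, hc1] at key
  have k1 : ∑ s, c s * (T' (F' s) - T j) ^ 2 = 0 := by
    have : ∑ s, c s * (T' (F' s) - T j) ^ 2 = ∑ s, c s * T (F s) ^ 2
        - 2 * T j * ∑ s, c s * T (F s) + (∑ s, c s) * T j ^ 2 := by
      rw [Finset.mul_sum, ← Finset.sum_sub_distrib, Finset.sum_mul, ← Finset.sum_add_distrib]
      exact Finset.sum_congr rfl fun i _ => by rw [hT]; ring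
    rw [this, hc1, hcT, hcT2]; ring
  have k2 : ∑ t, R * δ * (T' (J t) - T j) ^ 2 ≤ k * (R * δ) * D := by
    refine (Finset.sum_le_card_nsmul _ _ (R * δ * D) fun s _ => ?_).trans (by simp [mul_assoc])
    exact mul_le_mul_of_nonneg_left (hD _ _) hε
  have k3 : 0 ≤ ∑ _t : Fin k, R * δ := Finset.sum_nonneg fun _ _ => hε
  linarith

/-- The abscissae of the polygon coded by `g`. -/
def absc {n : ℕ} (j a : Fin n) : ℕ := j.val * n + a.val + 1

lemma absc_inj {n : ℕ} {j a j' a' : Fin n} (h : absc j a = absc j' a') : j = j' ∧ a = a' := by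
  unfold absc at h
  have hn : 0 < n := j.pos
  have h' : j.val * n + a.val = j'.val * n + a'.val := by omega
  have h1 : (a.val + n * j.val) / n = (a'.val + n * j'.val) / n := by
    congr 1; linarith [mul_comm n j.val, mul_comm n j'.val]
  rw [Nat.add_mul_div_left _ _ hn, Nat.add_mul_div_left _ _ hn, Nat.div_eq_of_lt a.2,
    Nat.div_eq_of_lt a'.2] at h1
  have h2 : j.val = j'.val := by omega
  rw [h2] at h'
  exact ⟨Fin.ext h2, Fin.ext (by omega)⟩

lemma absc_le {n : ℕ} (j a : Fin n) : absc j a ≤ n ^ 2 := by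
  unfold absc
  have := j.2
  have := a.2
  nlinarith [Nat.mul_le_mul_right n (show j.val + 1 ≤ n from j.2)]

lemma sq_sep {a b : ℕ} (h : a ≠ b) : (1 : ℝ) ≤ ((a : ℝ) - b) ^ 2 := by
  have h1 : (1 : ℤ) ≤ ((a : ℤ) - b) ^ 2 := by
    have : ((a : ℤ) - b) ≠ 0 := sub_ne_zero.mpr (by exact_mod_cast h)
    have := pow_pos (abs_pos.mpr this) 2
    rw [sq_abs] at this
    omega
  exact_mod_cast h1

/-- The vertices of the polygon coded by `g`. -/
def vert {n : ℕ} (g : Fin n → Fin n) (j : Fin n) : EuclideanSpace ℝ (Fin 2) :=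
  ppt (absc j (g j) : ℝ)

lemma vert_inj {n : ℕ} (g : Fin n → Fin n) : Function.Injective (vert g) := by
  intro i j h
  have h1 : vert g i 0 = vert g j 0 := by rw [h]
  simp only [vert, ppt_zero] at h1
  exact (absc_inj (by exact_mod_cast h1)).1

lemma vert_sep {n : ℕ} (g : Fin n → Fin n) (j : Fin n) (t : ℕ) (h : absc j (g j) ≠ t) :
    1 ≤ vert g j 1 - 2 * (t : ℝ) * vert g j 0 + (t : ℝ) ^ 2 := by
  simp only [vert, ppt_zero, ppt_one]
  have := sq_sep h
  linarith

/-- Pigeonhole over codes. -/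
lemma not_all_small (n k : ℕ) (hk : 1 ≤ k) (hkn : 225 * k ^ 2 < n) :
    ¬ ∀ g : Fin n → Fin n, HasLinExt (convexHull ℝ (Set.range (vert g))) k := by
  intro hall
  have hn : 0 < n := by omega
  have hd := fun g => exists_goodData hn (hall g) (fun j => (absc j (g j) : ℝ))
    (fun j => subset_convexHull ℝ _ ⟨j, rfl⟩)
  choose Z F hG using hd
  let M : ℕ := n ^ 5
  have hM : (0 : ℝ) < M := by positivity
  let code : (Fin n → Fin n) → (Fin (3 + k) → Fin n × Fin n) × (Fin (3 + k) → Fin k → Fin (M + 1)) :=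
    fun g => (fun s => (F g s, g (F g s)), fun s t => ⟨⌊Z g (F g s) t * M⌋₊, by
      have h1 := (hG g).2.1 (F g s) t
      have h0 := (hG g).1 (F g s) t
      apply Nat.lt_succ_of_le
      apply Nat.floor_le_of_le
      nlinarith⟩)
  have hcard : Fintype.card ((Fin (3 + k) → Fin n × Fin n) × (Fin (3 + k) → Fin k → Fin (M + 1)))
      < Fintype.card (Fin n → Fin n) := by
    simp only [Fintype.card_prod, Fintype.card_fun, Fintype.card_fin]
    have hM1 : M + 1 ≤ n ^ 6 := by
      have : 1 ≤ n ^ 5 := Nat.one_le_pow _ _ hn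
      calc n ^ 5 + 1 ≤ n ^ 5 * 2 := by omega
        _ ≤ n ^ 5 * n := Nat.mul_le_mul_left _ (by nlinarith)
        _ = n ^ 6 := by ring
    calc (n * n) ^ (3 + k) * ((M + 1) ^ k) ^ (3 + k)
        ≤ (n * n) ^ (3 + k) * ((n ^ 6) ^ k) ^ (3 + k) := by gcongr
      _ = n ^ (2 * (3 + k) + 6 * k * (3 + k)) := by
        rw [← pow_two, ← pow_mul, ← pow_mul, ← pow_mul, ← pow_add, mul_assoc 6]
      _ < n ^ n := by
        apply Nat.pow_lt_pow_right
        · nlinarith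
        · nlinarith
  obtain ⟨g, g', hne, hcode⟩ := Fintype.exists_ne_map_eq_of_card_lt code hcard
  obtain ⟨j, hj⟩ := Function.ne_iff.mp hne
  have hc1 : ∀ s, F g s = F g' s ∧ g (F g s) = g' (F g' s) := fun s => by
    have := congrFun (congrArg Prod.fst hcode) s
    simpa [code] using this
  have hc2 : ∀ s t, ⌊Z g (F g s) t * M⌋₊ = ⌊Z g' (F g' s) t * M⌋₊ := fun s t => by
    have := congrFun (congrFun (congrArg Prod.snd hcode) s) t
    simpa [code] using this
  refine core (hG g) (hG g') (1 / M) ((n : ℝ) ^ 4) (by positivity) ?_ ?_ ?_ ?_ j ?_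
  · intro s
    rw [(hc1 s).2, (hc1 s).1]
  · intro s t
    have e := hc2 s t
    have a1 := Nat.floor_le (mul_nonneg ((hG g).1 (F g s) t) hM.le)
    have a2 := Nat.lt_floor_add_one (Z g (F g s) t * M)
    have b1 := Nat.floor_le (mul_nonneg ((hG g').1 (F g' s) t) hM.le)
    have b2 := Nat.lt_floor_add_one (Z g' (F g' s) t * M)
    rw [← e] at b1 b2
    rw [le_div_iff₀ hM, ← abs_of_pos hM, ← abs_mul, abs_le]
    constructor <;> linarith
  · intro i j
    have a1 : (absc i (g' i) : ℝ) ≤ (n : ℝ) ^ 2 := by exact_mod_cast absc_le i (g' i)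
    have a2 : (absc j (g j) : ℝ) ≤ (n : ℝ) ^ 2 := by exact_mod_cast absc_le j (g j)
    have a3 : (0 : ℝ) ≤ absc i (g' i) := Nat.cast_nonneg _
    have a4 : (0 : ℝ) ≤ absc j (g j) := Nat.cast_nonneg _
    have : (n : ℝ) ^ 4 = ((n : ℝ) ^ 2) ^ 2 := by ring
    rw [this]
    exact sq_le_sq' (by linarith) (by linarith)
  · have hnR : (0 : ℝ) < n := by exact_mod_cast hn
    have e : (k : ℝ) * (((3 + k : ℕ) : ℝ) * (1 / (M : ℝ))) * (n : ℝ) ^ 4 = k * (3 + k) / n := by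
      simp only [M]; push_cast; field_simp
    rw [e, div_lt_one hnR]
    have : k * (3 + k) < n := by nlinarith
    exact_mod_cast this
  · apply hull_halfspace
    rintro _ ⟨i, rfl⟩
    apply vert_sep
    intro h
    obtain ⟨rfl, h2⟩ := absc_inj h
    exact hj h2.symm

lemma not_zero {d : ℕ} {S : Finset (EuclideanSpace ℝ (Fin d))} (P : Set (EuclideanSpace ℝ (Fin d)))
    (hP : P = convexHull ℝ (S : Set (EuclideanSpace ℝ (Fin d)))) {p q : EuclideanSpace ℝ (Fin d)}
    (hp : p ∈ P) (hq : q ∈ P) (hpq : p ≠ q) : ¬ HasLinExt P 0 := by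
  rintro ⟨m, φ, a, h⟩
  have hb : Bornology.IsBounded P := by
    rw [hP, isBounded_convexHull]
    exact S.finite_toSet.isBounded
  obtain ⟨C, hC⟩ := hb.exists_norm_le
  rw [h] at hp hq
  obtain ⟨x, -, rfl⟩ := hp
  obtain ⟨y, -, rfl⟩ := hq
  have hl : ∀ r : ℝ, AffineMap.lineMap (φ x) (φ y) r ∈ P := fun r => by
    rw [h, ← AffineMap.apply_lineMap]
    exact ⟨_, fun i => i.elim0, rfl⟩
  have hpos : 0 < ‖φ y - φ x‖ := norm_pos_iff.mpr (sub_ne_zero.mpr hpq.symm)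
  have hx := hC _ (hl 0)
  obtain ⟨N, hN⟩ := exists_nat_gt ((C + C) / ‖φ y - φ x‖)
  have h1 := hC _ (hl N)
  simp only [AffineMap.lineMap_apply_module'] at h1 hx
  simp only [zero_smul, zero_add] at hx
  rw [div_lt_iff₀ hpos] at hN
  have h2 : ‖(N : ℝ) • (φ y - φ x)‖ = N * ‖φ y - φ x‖ := by rw [norm_smul]; simp
  have h3 := norm_sub_le ((N : ℝ) • (φ y - φ x) + φ x) (φ x)
  rw [add_sub_cancel_right, h2] at h3
  linarith

lemma exists_g (n : ℕ) (hn : 2 ≤ n) : ∃ g : Fin n → Fin n,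
    ∀ l, HasLinExt (convexHull ℝ (Set.range (vert g))) l → Real.sqrt n / 15 ≤ l := by
  classical
  by_contra hcon
  push Not at hcon
  choose l hl hlt using hcon
  have h0 : ∀ g, 1 ≤ l g := fun g => by
    by_contra h
    have h : l g = 0 := by omega
    have h1 := hl g
    rw [h] at h1
    refine not_zero (S := Finset.univ.image (vert g)) (p := vert g ⟨0, by omega⟩)
      (q := vert g ⟨1, by omega⟩) (convexHull ℝ (Set.range (vert g))) (by simp)
      (subset_convexHull ℝ _ ⟨_, rfl⟩) (subset_convexHull ℝ _ ⟨_, rfl⟩)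
      ?_ h1
    intro h2
    have := vert_inj g h2
    simp at this
  have h1 : ∀ g, 225 * (l g) ^ 2 < n := fun g => by
    have h2 := hlt g
    rw [lt_div_iff₀ (by norm_num), Real.lt_sqrt (by positivity)] at h2
    have h3 : ((225 * (l g) ^ 2 : ℕ) : ℝ) < n := by push_cast; linarith
    exact_mod_cast h3
  obtain ⟨g0, -, hg0⟩ := Finset.exists_max_image (Finset.univ : Finset (Fin n → Fin n)) l
    ⟨id, Finset.mem_univ _⟩
  exact not_all_small n (l g0) (h0 g0) (h1 g0) fun g => (hl g).mono (hg0 g (Finset.mem_univ _))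

open Classical in
theorem statement17 (n : ℕ) (hn : 2 ≤ n) :
    ∃ (P : Set (EuclideanSpace ℝ (Fin 2))) (V : Finset (EuclideanSpace ℝ (Fin 2))),
      P = convexHull ℝ (V : Set (EuclideanSpace ℝ (Fin 2))) ∧
      V.card = n ∧
      (∀ v ∈ V, v ∉ convexHull ℝ ((V.erase v : Finset (EuclideanSpace ℝ (Fin 2))) :
          Set (EuclideanSpace ℝ (Fin 2)))) ∧
      (∀ v ∈ V, ∃ a b : ℕ, 1 ≤ a ∧ a ≤ n ^ 2 ∧ 1 ≤ b ∧ b ≤ n ^ 4 ∧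
          v = (EuclideanSpace.equiv (Fin 2) ℝ).symm ![(a : ℝ), (b : ℝ)]) ∧
      Real.sqrt n / 15 ≤ (xc P : ℝ) := by
  obtain ⟨g, hg⟩ := exists_g n hn
  have hcoe : ((Finset.univ.image (vert g) : Finset (EuclideanSpace ℝ (Fin 2))) :
      Set (EuclideanSpace ℝ (Fin 2))) = Set.range (vert g) := by simp
  refine ⟨convexHull ℝ (Set.range (vert g)), Finset.univ.image (vert g), by rw [hcoe], ?_, ?_, ?_, ?_⟩
  · rw [Finset.card_image_of_injective _ (vert_inj g)]; simp
  · intro v hv hmem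
    obtain ⟨j, -, rfl⟩ := Finset.mem_image.mp hv
    have h := hull_halfspace _ (absc j (g j) : ℝ) (fun u hu => ?_) _ hmem
    · simp only [vert, ppt_zero, ppt_one] at h
      nlinarith
    · obtain ⟨hne, hu⟩ := Finset.mem_erase.mp (Finset.mem_coe.mp hu)
      obtain ⟨i, -, rfl⟩ := Finset.mem_image.mp hu
      apply vert_sep
      intro h
      exact hne (by rw [(absc_inj h).1])
  · intro v hv
    obtain ⟨j, -, rfl⟩ := Finset.mem_image.mp hv
    have h1 : 1 ≤ absc j (g j) := Nat.le_add_left _ _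
    have h2 := absc_le j (g j)
    refine ⟨absc j (g j), absc j (g j) ^ 2, h1, h2, Nat.one_le_pow _ _ h1, ?_, ?_⟩
    · calc absc j (g j) ^ 2 ≤ (n ^ 2) ^ 2 := Nat.pow_le_pow_left h2 2
        _ = n ^ 4 := by ring
    · simp [vert, ppt]
  · apply hg
    have hP : ¬ (convexHull ℝ (Set.range (vert g)) = ∅ ∨
        ∃ p, convexHull ℝ (Set.range (vert g)) = {p}) := by
      have m0 : vert g ⟨0, by omega⟩ ∈ convexHull ℝ (Set.range (vert g)) :=
        subset_convexHull ℝ _ ⟨_, rfl⟩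
      have m1 : vert g ⟨1, by omega⟩ ∈ convexHull ℝ (Set.range (vert g)) :=
        subset_convexHull ℝ _ ⟨_, rfl⟩
      rintro (h | ⟨p, h⟩)
      · rw [h] at m0; exact m0
      · rw [h] at m0 m1
        have h2 := vert_inj g (m0.trans m1.symm)
        simp at h2
    rw [xc, if_neg hP]
    have hne : {l | HasLinExt (convexHull ℝ (Set.range (vert g))) l}.Nonempty :=
      ⟨n + 2, hasLinExt_hull (vert g)⟩
    exact Nat.sInf_mem hne
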